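/- arXiv:2602.06317 — 4 statements merged into one kernel-verified Lean document; each statement's English description precedes it below -/
import Mathlib

section
/- Let E be a real normed vector space, n ≥ 1, S : Fin n → ℝ attention scores with softmax weights A_j = exp(S_j) / ∑_t exp(S_t), v : Fin n → E value vectors with ‖v_j‖ ≤ M for all j, C ⊆ Fin n nonempty, and ε = ∑_{j ∉ C} A_j the excluded attention mass. Then the sparse attention output o^sparse = ∑_{j ∈ C} (A_j / (1 − ε)) v_j and the full attention output o^full = ∑_{j=0}^{n−1} A_j v_j satisfy ‖o^sparse − o^full‖ ≤ 2 ε M. -/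
open Finset

/-- Renormalizing a convex combination to a subset of positive mass moves it by at most twice the
discarded mass times a bound on the points. -/
theorem norm_renormalized_sum_sub_sum_le {ι E : Type*} [Fintype ι] [DecidableEq ι]
    [SeminormedAddCommGroup E] [NormedSpace ℝ E] {w : ι → ℝ} (hw : ∀ j, 0 ≤ w j)
    (hsum : ∑ j, w j = 1) {v : ι → E} {M : ℝ} (hv : ∀ j, ‖v j‖ ≤ M) {C : Finset ι}
    (hC : 0 < ∑ j ∈ C, w j) :
    ‖(∑ j ∈ C, (w j / ∑ i ∈ C, w i) • v j) - ∑ j, w j • v j‖ ≤ 2 * (∑ j ∈ Cᶜ, w j) * M := by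
  have hsplit := Finset.sum_add_sum_compl C w
  have hcompl : 0 ≤ ∑ j ∈ Cᶜ, w j := Finset.sum_nonneg fun j _ => hw j
  set s := ∑ j ∈ C, w j with hs
  have hs_le : s ≤ 1 := by linarith
  have hdiff : (∑ j ∈ C, (w j / s) • v j) - ∑ j, w j • v j =
      (∑ j ∈ C, (w j / s - w j) • v j) - ∑ j ∈ Cᶜ, w j • v j := by
    rw [← Finset.sum_add_sum_compl C fun j => w j • v j]
    simp only [sub_smul, Finset.sum_sub_distrib]
    abel
  have hbound : ∀ (T : Finset ι) (c : ι → ℝ), (∀ j, 0 ≤ c j) →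
      ‖∑ j ∈ T, c j • v j‖ ≤ (∑ j ∈ T, c j) * M := fun T c hc => by
    rw [Finset.sum_mul]
    refine norm_sum_le_of_le T fun j _ => ?_
    rw [norm_smul, Real.norm_of_nonneg (hc j)]
    exact mul_le_mul_of_nonneg_left (hv j) (hc j)
  have hexcess : ∑ j ∈ C, (w j / s - w j) = ∑ j ∈ Cᶜ, w j := by
    rw [Finset.sum_sub_distrib, ← Finset.sum_div, ← hs, div_self hC.ne']
    linarith
  calc ‖(∑ j ∈ C, (w j / s) • v j) - ∑ j, w j • v j‖
      ≤ ‖∑ j ∈ C, (w j / s - w j) • v j‖ + ‖∑ j ∈ Cᶜ, w j • v j‖ := by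
        rw [hdiff]
        exact norm_sub_le _ _
    _ ≤ (∑ j ∈ C, (w j / s - w j)) * M + (∑ j ∈ Cᶜ, w j) * M :=
        add_le_add (hbound C _ fun j => sub_nonneg.2 (le_div_self (hw j) hC hs_le))
          (hbound Cᶜ w hw)
    _ = 2 * (∑ j ∈ Cᶜ, w j) * M := by
        rw [hexcess]
        ring

/-- **Sparse attention error bound.** With softmax weights
`A_j = exp(S_j) / ∑_t exp(S_t)`, values `v_j` of norm at most `M`, a nonempty subset
`C`, and excluded mass `ε = ∑_{j ∉ C} A_j`, the sparse output
`∑_{j ∈ C} (A_j / (1 − ε)) v_j` differs from the full output `∑_j A_j v_j` by at most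
`2 ε M` in norm. -/
theorem sparse_attention_error_bound (E : Type*) [NormedAddCommGroup E]
    [NormedSpace ℝ E] (n : ℕ) (hn : 1 ≤ n) (S A : Fin n → ℝ)
    (hA : ∀ j, A j = Real.exp (S j) / ∑ t, Real.exp (S t))
    (v : Fin n → E) (M : ℝ) (hv : ∀ j, ‖v j‖ ≤ M)
    (C : Finset (Fin n)) (hC : C.Nonempty)
    (ε : ℝ) (hε : ε = ∑ j ∈ Cᶜ, A j) :
    ‖(∑ j ∈ C, (A j / (1 - ε)) • v j) - ∑ j, A j • v j‖ ≤ 2 * ε * M := by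
  have : Nonempty (Fin n) := ⟨⟨0, hn⟩⟩
  have hZ : 0 < ∑ t, Real.exp (S t) :=
    Finset.sum_pos (fun t _ => Real.exp_pos _) Finset.univ_nonempty
  have hpos : ∀ j, 0 < A j := fun j => by
    rw [hA]
    exact div_pos (Real.exp_pos _) hZ
  have hsum : ∑ j, A j = 1 := by
    simp only [hA]
    rw [← Finset.sum_div, div_self hZ.ne']
  have hmass : 1 - ε = ∑ j ∈ C, A j := by
    rw [hε, ← hsum, ← Finset.sum_add_sum_compl C A, add_sub_cancel_right]
  rw [hmass, hε]
  exact norm_renormalized_sum_sub_sum_le (fun j => (hpos j).le) hsum hv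
    (Finset.sum_pos (fun j _ => hpos j) hC)
end

section
/- Let E be a real normed vector space, n ≥ 1, S : Fin n → ℝ attention scores with softmax weights A_j = exp(S_j) / ∑_t exp(S_t), and v : Fin n → E value vectors with ‖v_j‖ ≤ M for all j. Let C ⊆ Fin n be nonempty and suppose there exists j₀ ∈ C with S_j ≤ S_{j₀} − Δ for all j ∉ C, where Δ ≥ 0. Then the sparse attention output o^sparse = ∑_{j ∈ C} (exp(S_j) / ∑_{t ∈ C} exp(S_t)) v_j and the full attention output o^full = ∑_j A_j v_j satisfy ‖o^sparse − o^full‖ ≤ 2 (n − |C|) · exp(−Δ) · M. -/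
open Finset

/-- Restricting a normalised weighted average of vectors of norm at most `M` to a subset `C`
moves it by at most `2 M` times the fraction of the weight lying outside `C`. -/
theorem norm_restricted_average_sub_average_le {E ι : Type*} [NormedAddCommGroup E]
    [NormedSpace ℝ E] [Fintype ι] [DecidableEq ι] {w : ι → ℝ} (hw : ∀ j, 0 ≤ w j)
    {v : ι → E} {M : ℝ} (hv : ∀ j, ‖v j‖ ≤ M) {C : Finset ι} (hC : 0 < ∑ t ∈ C, w t) :
    ‖(∑ j ∈ C, (w j / ∑ t ∈ C, w t) • v j) - ∑ j, (w j / ∑ t, w t) • v j‖ ≤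
      2 * ((∑ t ∈ Cᶜ, w t) / ∑ t, w t) * M := by
  have hsplit : ∑ t ∈ C, w t + ∑ t ∈ Cᶜ, w t = ∑ t, w t := Finset.sum_add_sum_compl C w
  have hD : 0 ≤ ∑ t ∈ Cᶜ, w t := Finset.sum_nonneg fun j _ => hw j
  rw [← Finset.sum_add_sum_compl C fun j => (w j / ∑ t, w t) • v j, ← sub_sub,
    ← Finset.sum_sub_distrib]
  simp only [← sub_smul]
  have hinside : ‖∑ j ∈ C, (w j / ∑ t ∈ C, w t - w j / ∑ t, w t) • v j‖ ≤
      ∑ j ∈ C, (w j / ∑ t ∈ C, w t - w j / ∑ t, w t) * M := by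
    refine norm_sum_le_of_le _ fun j _ => ?_
    have hnonneg : 0 ≤ w j / ∑ t ∈ C, w t - w j / ∑ t, w t :=
      sub_nonneg.2 (div_le_div_of_nonneg_left (hw j) hC (by linarith))
    rw [norm_smul, Real.norm_of_nonneg hnonneg]
    exact mul_le_mul_of_nonneg_left (hv j) hnonneg
  have houtside : ‖∑ j ∈ Cᶜ, (w j / ∑ t, w t) • v j‖ ≤ ∑ j ∈ Cᶜ, (w j / ∑ t, w t) * M := by
    refine norm_sum_le_of_le _ fun j _ => ?_
    have hnonneg : 0 ≤ w j / ∑ t, w t := div_nonneg (hw j) (by linarith)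
    rw [norm_smul, Real.norm_of_nonneg hnonneg]
    exact mul_le_mul_of_nonneg_left (hv j) hnonneg
  refine (norm_sub_le _ _).trans ((add_le_add hinside houtside).trans_eq ?_)
  rw [← Finset.sum_mul, ← Finset.sum_mul, Finset.sum_sub_distrib, ← Finset.sum_div,
    ← Finset.sum_div, ← Finset.sum_div, ← hsplit]
  have hne : ∑ t ∈ C, w t + ∑ t ∈ Cᶜ, w t ≠ 0 := by linarith
  field_simp
  ring

/-- If every score outside `C` is at least `Δ` below `S j₀`, the softmax mass outside `C` is at
most `|Cᶜ| exp (-Δ)`. -/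
theorem softmax_mass_compl_le {ι : Type*} [Fintype ι] [DecidableEq ι] {S : ι → ℝ}
    {C : Finset ι} {j₀ : ι} {Δ : ℝ} (hgap : ∀ j ∉ C, S j ≤ S j₀ - Δ) :
    (∑ t ∈ Cᶜ, Real.exp (S t)) / ∑ t, Real.exp (S t) ≤ (Cᶜ.card : ℝ) * Real.exp (-Δ) := by
  have hj₀ : Real.exp (S j₀) ≤ ∑ t, Real.exp (S t) :=
    Finset.single_le_sum (f := fun t => Real.exp (S t)) (fun t _ => (Real.exp_pos _).le)
      (Finset.mem_univ j₀)
  rw [div_le_iff₀ ((Real.exp_pos _).trans_le hj₀)]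
  calc ∑ t ∈ Cᶜ, Real.exp (S t) ≤ Cᶜ.card • (Real.exp (-Δ) * Real.exp (S j₀)) := by
        refine Finset.sum_le_card_nsmul _ _ _ fun j hj => ?_
        rw [← Real.exp_add]
        exact Real.exp_le_exp.2 (by linarith [hgap j (Finset.mem_compl.1 hj)])
    _ = (Cᶜ.card : ℝ) * Real.exp (-Δ) * Real.exp (S j₀) := by rw [nsmul_eq_mul, mul_assoc]
    _ ≤ (Cᶜ.card : ℝ) * Real.exp (-Δ) * ∑ t, Real.exp (S t) := by gcongr

/-- **Score gap controls output error.** With softmax weights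
`A_j = exp(S_j) / ∑_t exp(S_t)`, values of norm at most `M`, and a nonempty subset `C`
admitting a score gap `Δ ≥ 0` (some `j₀ ∈ C` with `S_j ≤ S_{j₀} − Δ` for all `j ∉ C`),
the sparse output `∑_{j ∈ C} (exp(S_j)/∑_{t ∈ C} exp(S_t)) v_j` differs from the full
output `∑_j A_j v_j` by at most `2 (n − |C|) exp(−Δ) M` in norm. -/
theorem score_gap_output_error_bound (E : Type*) [NormedAddCommGroup E]
    [NormedSpace ℝ E] (n : ℕ) (hn : 1 ≤ n) (S A : Fin n → ℝ)
    (hA : ∀ j, A j = Real.exp (S j) / ∑ t, Real.exp (S t))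
    (v : Fin n → E) (M : ℝ) (hv : ∀ j, ‖v j‖ ≤ M)
    (C : Finset (Fin n)) (hC : C.Nonempty) (j₀ : Fin n) (hj₀ : j₀ ∈ C)
    (Δ : ℝ) (hΔ : 0 ≤ Δ) (hgap : ∀ j ∉ C, S j ≤ S j₀ - Δ) :
    ‖(∑ j ∈ C, (Real.exp (S j) / (∑ t ∈ C, Real.exp (S t))) • v j) -
        ∑ j, A j • v j‖ ≤ 2 * ((n - C.card : ℕ) : ℝ) * Real.exp (-Δ) * M := by
  have hM : 0 ≤ M := (norm_nonneg _).trans (hv j₀)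
  have hmass := softmax_mass_compl_le hgap
  rw [Finset.card_compl, Fintype.card_fin] at hmass
  simp only [hA]
  refine (norm_restricted_average_sub_average_le (fun j => (Real.exp_pos (S j)).le) hv
    (Finset.sum_pos (fun j _ => Real.exp_pos _) hC)).trans ?_
  rw [mul_assoc 2 _ (Real.exp (-Δ))]
  gcongr
end

section
/- Let E be a real inner product space and let u, v ∈ E with ‖v‖ ≥ r and ‖u − v‖ ≤ δ, where 0 ≤ δ < r. Then the inner product satisfies ⟪u, v⟫ ≥ ‖u‖·‖v‖·(1 − δ² / (2 r (r − δ))); equivalently, the cosine similarity between u and v is at least 1 − δ² / (2 r (r − δ)). In particular, small output error relative to output norm forces cosine similarity close to 1. -/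
open scoped RealInnerProductSpace

/-- **Small relative error forces cosine similarity close to 1.** In a real inner
product space, if `‖v‖ ≥ r` and `‖u − v‖ ≤ δ` with `0 ≤ δ < r`, then
`⟪u, v⟫ ≥ ‖u‖·‖v‖·(1 − δ²/(2r(r − δ)))`; equivalently the cosine similarity
`⟪u, v⟫ / (‖u‖·‖v‖)` is at least `1 − δ²/(2r(r − δ))`. -/
theorem cosine_similarity_lower_bound (E : Type*) [NormedAddCommGroup E]
    [InnerProductSpace ℝ E] (u v : E) (r δ : ℝ) (hδ : 0 ≤ δ) (hδr : δ < r)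
    (hv : r ≤ ‖v‖) (huv : ‖u - v‖ ≤ δ) :
    ‖u‖ * ‖v‖ * (1 - δ ^ 2 / (2 * r * (r - δ))) ≤ ⟪u, v⟫ ∧
    1 - δ ^ 2 / (2 * r * (r - δ)) ≤ ⟪u, v⟫ / (‖u‖ * ‖v‖) := by
  have hr : 0 < r := hδ.trans_lt hδr
  have hrδ : 0 < r - δ := sub_pos.mpr hδr
  have hu : r - δ ≤ ‖u‖ := by
    have h := norm_sub_norm_le v u
    rw [norm_sub_rev] at h
    linarith
  have hprod : r * (r - δ) ≤ ‖u‖ * ‖v‖ := by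
    rw [mul_comm ‖u‖]
    gcongr
  have hpos : 0 < ‖u‖ * ‖v‖ := (mul_pos hr hrδ).trans_le hprod
  have hsq : ‖u - v‖ ^ 2 ≤ δ ^ 2 := by gcongr
  rw [norm_sub_sq_real] at hsq
  have hinner : ‖u‖ * ‖v‖ - δ ^ 2 / 2 ≤ ⟪u, v⟫ := by
    linarith [sq_nonneg (‖u‖ - ‖v‖)]
  have hdefect : δ ^ 2 / 2 ≤ ‖u‖ * ‖v‖ * (δ ^ 2 / (2 * r * (r - δ))) := by
    calc δ ^ 2 / 2 = r * (r - δ) * (δ ^ 2 / (2 * r * (r - δ))) := by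
          field_simp
      _ ≤ ‖u‖ * ‖v‖ * (δ ^ 2 / (2 * r * (r - δ))) := by gcongr
  have hmain : ‖u‖ * ‖v‖ * (1 - δ ^ 2 / (2 * r * (r - δ))) ≤ ⟪u, v⟫ := by
    linarith
  exact ⟨hmain, (le_div_iff₀' hpos).mpr hmain⟩
end

section
/- Let E be a real normed vector space, n ≥ 1, S : Fin n → ℝ attention scores with softmax weights A_j = exp(S_j) / ∑_t exp(S_t), v : Fin n → E values with ‖v_j‖ ≤ M, and C ⊆ Fin n nonempty with a score gap: some j₀ ∈ C satisfies S_j ≤ S_{j₀} − Δ for all j ∉ C, Δ ≥ 0. Let w : Fin m → (E →L[ℝ] ℝ) be readout functionals with ‖w_j‖ ≤ Λ, and suppose the full-attention logits z_j = w_j(o^full), where o^full = ∑_j A_j v_j, have a unique maximizer j* with gap γ. If 4·Λ·(n − |C|)·exp(−Δ)·M < γ, then the sparse-attention logits z'_j = w_j(o^sparse), where o^sparse = ∑_{j ∈ C} (exp(S_j) / ∑_{t ∈ C} exp(S_t)) v_j, have the same unique maximizer j*. That is, a sufficient score gap on the Condensate Set guarantees token-level equivalence of greedy decoding between sparse and full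 attention. -/
open Finset

/-- Renormalizing positive weights `a` to a subset `C` moves the weighted mean of `v` by at
most `2 * M` times the relative weight of the complement of `C`. -/
theorem norm_restrict_mean_sub_mean_le {ι E : Type*} [Fintype ι] [DecidableEq ι]
    [NormedAddCommGroup E] [NormedSpace ℝ E] (a : ι → ℝ) (ha : ∀ i, 0 < a i)
    (v : ι → E) {M : ℝ} (hv : ∀ i, ‖v i‖ ≤ M) {C : Finset ι} (hC : C.Nonempty) :
    ‖∑ i ∈ C, (a i / ∑ t ∈ C, a t) • v i - ∑ i, (a i / ∑ t, a t) • v i‖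
      ≤ (∑ i ∈ Cᶜ, a i / ∑ t, a t) * (2 * M) := by
  have hZC : 0 < ∑ t ∈ C, a t := Finset.sum_pos (fun i _ => ha i) hC
  have hZ : 0 < ∑ t, a t :=
    hZC.trans_le (Finset.sum_le_univ_sum_of_nonneg fun i => (ha i).le)
  set o := ∑ i ∈ C, (a i / ∑ t ∈ C, a t) • v i with ho
  have ho_norm : ‖o‖ ≤ M := by
    calc ‖o‖ ≤ ∑ i ∈ C, a i / (∑ t ∈ C, a t) * M := by
          refine norm_sum_le_of_le _ fun i _ => ?_
          have hpos : 0 ≤ a i / ∑ t ∈ C, a t := div_nonneg (ha i).le hZC.le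
          rw [norm_smul, Real.norm_of_nonneg hpos]
          exact mul_le_mul_of_nonneg_left (hv i) hpos
      _ = M := by rw [← Finset.sum_mul, ← Finset.sum_div, div_self hZC.ne', one_mul]
  have hCsum : ∑ i ∈ C, (a i / ∑ t, a t) • v i = (∑ i ∈ C, a i / ∑ t, a t) • o := by
    rw [ho, Finset.smul_sum, ← Finset.sum_div]
    refine Finset.sum_congr rfl fun i _ => ?_
    rw [smul_smul]
    congr 1
    field_simp
  have hone : ∑ i ∈ C, a i / (∑ t, a t) + ∑ i ∈ Cᶜ, a i / (∑ t, a t) = 1 := by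
    rw [Finset.sum_add_sum_compl, ← Finset.sum_div, div_self hZ.ne']
  have hdiff : o - ∑ i, (a i / ∑ t, a t) • v i
      = ∑ i ∈ Cᶜ, (a i / ∑ t, a t) • (o - v i) := by
    rw [← Finset.sum_add_sum_compl C fun i => (a i / ∑ t, a t) • v i, hCsum,
      eq_sub_of_add_eq hone]
    simp only [smul_sub, Finset.sum_sub_distrib, ← Finset.sum_smul, sub_smul, one_smul]
    abel
  rw [hdiff, Finset.sum_mul]
  refine norm_sum_le_of_le _ fun i _ => ?_
  have hpos : 0 ≤ a i / ∑ t, a t := div_nonneg (ha i).le hZ.le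
  rw [norm_smul, Real.norm_of_nonneg hpos]
  refine mul_le_mul_of_nonneg_left ?_ hpos
  linarith [norm_sub_le o (v i), hv i]

/-- A score that lies `Δ` below another one has softmax weight at most `exp (-Δ)`. -/
theorem softmax_le_exp_neg {ι : Type*} [Fintype ι] (S : ι → ℝ) {i j : ι} {Δ : ℝ}
    (h : S i ≤ S j - Δ) : Real.exp (S i) / ∑ t, Real.exp (S t) ≤ Real.exp (-Δ) := by
  have hj : Real.exp (S j) ≤ ∑ t, Real.exp (S t) :=
    Finset.single_le_sum (f := fun t => Real.exp (S t)) (fun t _ => (Real.exp_pos _).le)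
      (Finset.mem_univ j)
  rw [div_le_iff₀ ((Real.exp_pos _).trans_le hj)]
  calc Real.exp (S i) ≤ Real.exp (-Δ) * Real.exp (S j) := by
        rw [← Real.exp_add]
        exact Real.exp_le_exp.mpr (by linarith)
    _ ≤ _ := mul_le_mul_of_nonneg_left hj (Real.exp_pos _).le

/-- **Token-level equivalence of sparse and full attention.** With softmax weights
`A_j = exp(S_j)/∑_t exp(S_t)`, values of norm at most `M`, a nonempty subset `C` with a
score gap `Δ ≥ 0` (some `j₀ ∈ C` with `S_j ≤ S_{j₀} − Δ` for all `j ∉ C`), and readout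
functionals `w_j` with `‖w_j‖ ≤ Λ` whose full-attention logits `z_j = w_j(o^full)` have
a unique maximizer `j*` with gap `γ`: if `4·Λ·(n − |C|)·exp(−Δ)·M < γ`, then the
sparse-attention logits `z'_j = w_j(o^sparse)` have the same unique maximizer `j*`. -/
theorem score_gap_token_equivalence (E : Type*) [NormedAddCommGroup E]
    [NormedSpace ℝ E] (n m : ℕ) (hn : 1 ≤ n) (hm : 1 ≤ m)
    (S A : Fin n → ℝ) (hA : ∀ j, A j = Real.exp (S j) / ∑ t, Real.exp (S t))
    (v : Fin n → E) (M : ℝ) (hv : ∀ j, ‖v j‖ ≤ M)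
    (C : Finset (Fin n)) (hC : C.Nonempty) (j₀ : Fin n) (hj₀ : j₀ ∈ C)
    (Δ : ℝ) (hΔ : 0 ≤ Δ) (hgap : ∀ j ∉ C, S j ≤ S j₀ - Δ)
    (w : Fin m → (E →L[ℝ] ℝ)) (Λ : ℝ) (hw : ∀ j, ‖w j‖ ≤ Λ)
    (ofull osparse : E)
    (hofull : ofull = ∑ j, A j • v j)
    (hosparse : osparse = ∑ j ∈ C, (Real.exp (S j) / (∑ t ∈ C, Real.exp (S t))) • v j)
    (z z' : Fin m → ℝ) (hz : ∀ j, z j = w j ofull) (hz' : ∀ j, z' j = w j osparse)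
    (jstar : Fin m) (hmax : ∀ j, j ≠ jstar → z j < z jstar)
    (γ : ℝ) (hγ : γ = z jstar - sSup {x : ℝ | ∃ j, j ≠ jstar ∧ z j = x})
    (hcond : 4 * Λ * ((n - C.card : ℕ) : ℝ) * Real.exp (-Δ) * M < γ) :
    ∀ j, j ≠ jstar → z' j < z' jstar := by
  intro j hj
  have hM : 0 ≤ M := (norm_nonneg _).trans (hv j₀)
  have hΛ : 0 ≤ Λ := (norm_nonneg _).trans (hw j)
  have hsum : ∑ i ∈ Cᶜ, Real.exp (S i) / ∑ t, Real.exp (S t)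
      ≤ ((n - C.card : ℕ) : ℝ) * Real.exp (-Δ) := by
    have := Finset.sum_le_card_nsmul Cᶜ (fun i => Real.exp (S i) / ∑ t, Real.exp (S t))
      (Real.exp (-Δ)) fun i hi => softmax_le_exp_neg S (hgap i (Finset.mem_compl.mp hi))
    rwa [Finset.card_compl, Fintype.card_fin, nsmul_eq_mul] at this
  have hout : ‖osparse - ofull‖ ≤ ((n - C.card : ℕ) : ℝ) * Real.exp (-Δ) * (2 * M) := by
    rw [hosparse, hofull]
    simp only [hA]
    exact (norm_restrict_mean_sub_mean_le (fun i => Real.exp (S i))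
      (fun i => Real.exp_pos _) v hv hC).trans
      (mul_le_mul_of_nonneg_right hsum (by positivity))
  have hlogit : ∀ k, |z' k - z k|
      ≤ Λ * (((n - C.card : ℕ) : ℝ) * Real.exp (-Δ) * (2 * M)) := by
    intro k
    rw [hz, hz', ← map_sub, ← Real.norm_eq_abs]
    exact (w k).le_of_opNorm_le_of_le (hw k) hout
  have hsup : z j ≤ sSup {x : ℝ | ∃ j, j ≠ jstar ∧ z j = x} := by
    refine le_csSup ⟨z jstar, ?_⟩ ⟨j, hj, rfl⟩
    rintro _ ⟨k, hk, rfl⟩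
    exact (hmax k hk).le
  have h₁ := (abs_le.mp (hlogit j)).2
  have h₂ := (abs_le.mp (hlogit jstar)).1
  linarith
end
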